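/- Let b_{kj} ∈ ℂ for integers k ≥ 1 and j ≥ 0, set ‖b_j‖ = (Σ_{k≥1} |b_{kj}|²)^{1/2}, and assume Σ_{j≥0} ‖b_j‖ < ∞ and Σ_{j≥0} (j+1)‖b_j‖ < ∞. Let ℓ² be the Hilbert space of square-summable complex families indexed by pairs (p,k) with p ≥ 0, k ≥ 1. Then for all p, q ≥ 0 and k, n ≥ 1 the series Q_{kn}(p,q) = Σ_{s≥0} b_{k, s+p} · conj(b_{n, s+q}) converges absolutely, and the formula (Qx)_{(p,k)} = Σ_{q≥0} Σ_{n≥1} Q_{kn}(p,q) x_{(q,n)} defines a bounded linear operator Q on ℓ² which is self-adjoint, positive semidefinite (⟨Qx, x⟩ ≥ 0 for all x), and compact. -/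

import Mathlib

open scoped ComplexOrder

section RankOne

open InnerProductSpace

variable {ι H : Type*} [NormedAddCommGroup H] [InnerProductSpace ℂ H]

theorem isCompactOperator_rankOne (x y : H) : IsCompactOperator (rankOne ℂ x y) := by
  rw [rankOne_def']
  exact (isCompactOperator_of_locallyCompactSpace_rng
    (ContinuousLinearMap.toSpanSingleton ℂ x)).comp_clm (innerSL ℂ y)

variable [CompleteSpace H]

theorem summable_rankOne_self {v : ι → H} (hv : Summable fun s => ‖v s‖ ^ 2) :
    Summable fun s => rankOne ℂ (v s) (v s) :=
  Summable.of_norm (by simpa [sq] using hv)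

theorem hasSum_rankOne_self_apply {v : ι → H} (hv : Summable fun s => ‖v s‖ ^ 2) (x : H) :
    HasSum (fun s => inner ℂ (v s) x • v s) ((∑' s, rankOne ℂ (v s) (v s)) x) := by
  simpa using (summable_rankOne_self hv).hasSum.mapL (ContinuousLinearMap.apply ℂ H x)

theorem isSelfAdjoint_tsum_rankOne_self (v : ι → H) :
    IsSelfAdjoint (∑' s, rankOne ℂ (v s) (v s)) := by
  rw [isSelfAdjoint_iff, tsum_star]
  simp [ContinuousLinearMap.star_eq_adjoint]

theorem inner_tsum_rankOne_self_nonneg {v : ι → H} (hv : Summable fun s => ‖v s‖ ^ 2) (x : H) :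
    0 ≤ inner ℂ ((∑' s, rankOne ℂ (v s) (v s)) x) x := by
  have hsum := (hasSum_rankOne_self_apply hv x).mapL (innerSL ℂ x)
  have h : 0 ≤ inner ℂ x ((∑' s, rankOne ℂ (v s) (v s)) x) := by
    refine hsum.nonneg fun s => ?_
    rw [innerSL_apply_apply, inner_smul_right, ← inner_conj_symm x (v s)]
    exact mul_star_self_nonneg _
  rw [← inner_conj_symm]
  exact star_nonneg_iff.mpr h

theorem isCompactOperator_tsum_rankOne_self {v : ι → H} (hv : Summable fun s => ‖v s‖ ^ 2) :
    IsCompactOperator (∑' s, rankOne ℂ (v s) (v s) : H →L[ℂ] H) := by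
  refine isCompactOperator_of_tendsto (summable_rankOne_self hv).hasSum
    (Filter.Eventually.of_forall fun t => ?_)
  exact Submodule.sum_mem (compactOperator (RingHom.id ℂ) H H) fun s _ =>
    isCompactOperator_rankOne (v s) (v s)

end RankOne

theorem summable_prod_add_of_summable_succ_mul {f : ℕ → ℝ} (hf : ∀ j, 0 ≤ f j)
    (h : Summable fun j : ℕ => ((j : ℝ) + 1) * f j) :
    Summable fun i : ℕ × ℕ => f (i.1 + i.2) := by
  rw [← Finset.HasAntidiagonal.sigmaAntidiagonalEquivProd.summable_iff]
  refine (summable_sigma_of_nonneg fun _ => hf _).2 ⟨fun _ => Summable.of_finite, h.congr fun j => ?_⟩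
  have hj : ∀ i : Finset.HasAntidiagonal.antidiagonal j, f (i.1.1 + i.1.2) = f j := fun i => by
    rw [Finset.HasAntidiagonal.mem_antidiagonal.mp i.2]
  simp [Finset.HasAntidiagonal.sigmaAntidiagonalEquivProd, tsum_fintype, hj]

theorem summable_succ_mul_sq {c : ℕ → ℝ} (hc : ∀ j, 0 ≤ c j)
    (h : Summable fun j : ℕ => ((j : ℝ) + 1) * c j) :
    Summable fun j : ℕ => ((j : ℝ) + 1) * c j ^ 2 := by
  refine h.of_norm_bounded_eventually_nat ?_
  filter_upwards [h.tendsto_atTop_zero.eventually (gt_mem_nhds one_pos)] with j hj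
  have h1 : c j ≤ 1 := by nlinarith [hc j, j.cast_nonneg (α := ℝ)]
  rw [Real.norm_of_nonneg (by positivity)]
  gcongr
  nlinarith [hc j]

theorem summable_norm_sq_shift {b : ℕ → ℕ → ℂ}
    (hb2 : ∀ j : ℕ, Summable (fun k : ℕ => ‖b k j‖ ^ 2))
    (hb' : Summable (fun j : ℕ => ((j : ℝ) + 1) * Real.sqrt (∑' k : ℕ, ‖b k j‖ ^ 2))) :
    Summable fun i : ℕ × ℕ × ℕ => ‖b i.2.2 (i.1 + i.2.1)‖ ^ 2 := by
  rw [← (Equiv.prodAssoc ℕ ℕ ℕ).summable_iff]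
  refine (summable_prod_of_nonneg fun _ => sq_nonneg _).2
    ⟨fun i => hb2 (i.1 + i.2), summable_prod_add_of_summable_succ_mul
      (f := fun j => ∑' k, ‖b k j‖ ^ 2) (fun j => tsum_nonneg fun k => sq_nonneg _) ?_⟩
  refine (summable_succ_mul_sq (fun j => Real.sqrt_nonneg _) hb').congr fun j => ?_
  rw [Real.sq_sqrt (tsum_nonneg fun k => sq_nonneg _)]

theorem summable_norm_mul_of_sq {ι R : Type*} [NormedDivisionRing R] {f g : ι → R}
    (hf : Summable fun i => ‖f i‖ ^ 2) (hg : Summable fun i => ‖g i‖ ^ 2) :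
    Summable fun i => ‖f i * g i‖ := by
  refine (hf.add hg).of_nonneg_of_le (fun _ => norm_nonneg _) fun i => ?_
  rw [norm_mul]
  nlinarith [sq_nonneg (‖f i‖ - ‖g i‖), sq_nonneg (‖f i‖), sq_nonneg (‖g i‖)]

theorem memℓp_two_of_summable_sq {ι : Type*} {f : ι → ℂ} (hf : Summable fun i => ‖f i‖ ^ 2) :
    Memℓp f 2 :=
  memℓp_gen (by simpa using hf)

theorem lp_two_norm_sq {ι : Type*} (f : lp (fun _ : ι => ℂ) 2) : ‖f‖ ^ 2 = ∑' i, ‖f i‖ ^ 2 := by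
  simpa using lp.norm_rpow_eq_tsum (p := 2) (by simp) f

theorem lp_two_summable_norm_sq {ι : Type*} (f : lp (fun _ : ι => ℂ) 2) :
    Summable fun i => ‖f i‖ ^ 2 := by
  simpa using (lp.memℓp f).summable (by simp)

/-- For square-summable `w` on `ι × κ`, with columns `w (s, ·)`, the weighted products of a
square-summable family in `s` with `w` and a vector of `ℓ²(κ)` are summable over `ι × κ`. -/
theorem summable_mul_conj_mul {ι κ : Type*} {a : ι → ℂ} {w : ι × κ → ℂ}
    (ha : Summable fun s => ‖a s‖ ^ 2) (hw : Summable fun i => ‖w i‖ ^ 2)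
    (x : lp (fun _ : κ => ℂ) 2) :
    Summable fun i : ι × κ => a i.1 * (starRingEnd ℂ) (w i) * x i.2 := by
  have hax : Summable fun i : ι × κ => ‖a i.1 * x i.2‖ ^ 2 := by
    simpa [mul_pow] using ha.mul_of_nonneg (lp_two_summable_norm_sq x)
      (fun _ => by positivity) (fun _ => by positivity)
  refine (summable_norm_mul_of_sq hax hw).of_norm_bounded fun i => le_of_eq ?_
  simp only [norm_mul, RCLike.norm_conj]
  ring

/-- Under `Σ_j ‖b_j‖ < ∞` and `Σ_j (j+1)‖b_j‖ < ∞` (with `‖b_j‖ = (Σ_k |b_{kj}|²)^{1/2}`),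
the series `Q_{kn}(p,q) = Σ_{s≥0} b_{k,s+p} conj(b_{n,s+q})` converge absolutely and the
matrix `{Q_{kn}(p,q)}` defines a bounded linear operator on `ℓ²` (indexed by pairs `(p,k)`)
which is self-adjoint, positive semidefinite and compact. -/
theorem Q_selfadjoint_compact (b : ℕ → ℕ → ℂ)
    (hb2 : ∀ j : ℕ, Summable (fun k : ℕ => ‖b k j‖ ^ 2))
    (hb : Summable (fun j : ℕ => Real.sqrt (∑' k : ℕ, ‖b k j‖ ^ 2)))
    (hb' : Summable (fun j : ℕ => ((j : ℝ) + 1) * Real.sqrt (∑' k : ℕ, ‖b k j‖ ^ 2))) :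
    (∀ p q k n : ℕ,
      Summable (fun s : ℕ => ‖b k (s + p) * (starRingEnd ℂ) (b n (s + q))‖)) ∧
    ∃ Q : lp (fun _ : ℕ × ℕ => ℂ) 2 →L[ℂ] lp (fun _ : ℕ × ℕ => ℂ) 2,
      (∀ (x : lp (fun _ : ℕ × ℕ => ℂ) 2) (p k : ℕ),
        (Q x) (p, k) = ∑' q : ℕ, ∑' n : ℕ,
          (∑' s : ℕ, b k (s + p) * (starRingEnd ℂ) (b n (s + q))) * x (q, n)) ∧
      IsSelfAdjoint Q ∧
      (∀ x, (0 : ℂ) ≤ inner (𝕜 := ℂ) (Q x) x) ∧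
      IsCompactOperator Q := by
  have hw := summable_norm_sq_shift hb2 hb'
  have hrow : ∀ p k : ℕ, Summable fun s => ‖b k (s + p)‖ ^ 2 := fun p k =>
    hw.comp_injective (i := fun s : ℕ => (s, p, k)) fun s t h => congrArg Prod.fst h
  refine ⟨fun p q k n => summable_norm_mul_of_sq (hrow p k) (by simpa using hrow q n), ?_⟩
  let v : ℕ → lp (fun _ : ℕ × ℕ => ℂ) 2 := fun s =>
    ⟨fun i => b i.2 (s + i.1), memℓp_two_of_summable_sq (hw.prod_factor s)⟩
  have hv : Summable fun s => ‖v s‖ ^ 2 := hw.prod.congr fun s => (lp_two_norm_sq (v s)).symm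
  refine ⟨∑' s, InnerProductSpace.rankOne ℂ (v s) (v s), fun x p k => ?_,
    isSelfAdjoint_tsum_rankOne_self v, inner_tsum_rankOne_self_nonneg hv,
    isCompactOperator_tsum_rankOne_self hv⟩
  have hsum : Summable fun i : ℕ × ℕ × ℕ =>
      b k (i.1 + p) * (starRingEnd ℂ) (b i.2.2 (i.1 + i.2.1)) * x i.2 :=
    summable_mul_conj_mul (hrow p k) hw x
  have hcoord := ((hasSum_rankOne_self_apply hv x).mapL
    (lp.evalCLM ℂ (fun _ : ℕ × ℕ => ℂ) 2 (p, k))).tsum_eq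
  calc _ = ∑' s, ∑' i : ℕ × ℕ, b k (s + p) * (starRingEnd ℂ) (b i.2 (s + i.1)) * x i := by
        refine hcoord.symm.trans (tsum_congr fun s => ?_)
        change inner ℂ (v s) x * b k (s + p) = _
        rw [lp.inner_eq_tsum, ← tsum_mul_right]
        refine tsum_congr fun i => ?_
        change x i * (starRingEnd ℂ) (b i.2 (s + i.1)) * b k (s + p) = _
        ring
    _ = ∑' i : ℕ × ℕ, ∑' s, b k (s + p) * (starRingEnd ℂ) (b i.2 (s + i.1)) * x i :=
        hsum.prod_symm.tsum_comm
    _ = _ := by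
        refine hsum.prod_symm.prod.tsum_prod.trans ?_
        exact tsum_congr fun q => tsum_congr fun n =>
          tsum_mul_right (f := fun s => b k (s + p) * (starRingEnd ℂ) (b n (s + q)))
            (a := x (q, n))
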